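/- Let β ∈ [1,2] with y ≠ 0, set I := {i : y_i > 0} and K̃ := ∪_{i ∈ I} supp(a_i). Let μ₀ ∈ M₊(K) satisfy K̃ ⊆ supp(μ₀), and define recursively μ_{k+1} := f_{k+1}·μ_k (the measure with density f_{k+1} with respect to μ_k), where f_{k+1}(x) := (Σ_{i=1}^m (Aμ_k)_i^{β−2} y_i a_i(x)) / (Σ_{i=1}^m (Aμ_k)_i^{β−1} a_i(x)) with the conventions that any numerator term with y_i = 0 equals 0, that 0^0 = 1, and that 0/0 = 0. Then all iterates μ_k are well-defined elements of M₊(K); for every k ≥ 1 one has supp(y) ⊆ supp(Aμ_k) and supp(μ_k) = K̃; and the objective decreases along the iterates: D_β(y|Aμ_{k+1}) ≤ D_β(y|Aμ_k) for every k ≥ 0. -/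

import Mathlib

open MeasureTheory Real Set

noncomputable def dbeta (β u v : ℝ) : EReal :=
  if β = 0 then
    if u = 0 ∨ v = 0 then ⊤ else ((u / v - Real.log (u / v) - 1 : ℝ) : EReal)
  else if β = 1 then
    if v = 0 ∧ 0 < u then ⊤ else ((v - u - u * Real.log (v / u) : ℝ) : EReal)
  else if β < 1 then
    if v = 0 ∧ 0 < u then ⊤
    else (((u ^ β + (β - 1) * v ^ β - β * u * v ^ (β - 1)) / (β * (β - 1)) : ℝ) : EReal)
  else (((u ^ β + (β - 1) * v ^ β - β * u * v ^ (β - 1)) / (β * (β - 1)) : ℝ) : EReal)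

noncomputable def Dbeta {m : ℕ} (β : ℝ) (y w : Fin m → ℝ) : EReal :=
  ∑ i, dbeta β (y i) (w i)

noncomputable def lamvec {m : ℕ} (β : ℝ) (y w : Fin m → ℝ) : Fin m → ℝ := fun i =>
  if 0 < w i then (w i) ^ (β - 2) * (w i - y i)
  else if β = 2 then -(y i) else 0

noncomputable def PP {X : Type*} [TopologicalSpace X] {m : ℕ} (a : Fin m → C(X, ℝ)) (y : Fin m → ℝ)
    (β : ℝ) (w : Fin m → ℝ) (x : X) : ℝ :=
  ∑ i, (if y i = 0 then 0 else (w i) ^ (β - 2) * y i * a i x)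

noncomputable def QQ {X : Type*} [TopologicalSpace X] {m : ℕ} (a : Fin m → C(X, ℝ))
    (β : ℝ) (w : Fin m → ℝ) (x : X) : ℝ :=
  ∑ i, (w i) ^ (β - 1) * a i x

noncomputable def ff {X : Type*} [TopologicalSpace X] {m : ℕ} (a : Fin m → C(X, ℝ)) (y : Fin m → ℝ)
    (β : ℝ) (w : Fin m → ℝ) (x : X) : ℝ := PP a y β w x / QQ a β w x

noncomputable def psi (β s : ℝ) : ℝ := if β = 1 then Real.log s else (s ^ (β - 1) - 1) / (β - 1)

theorem pow_tangent {β : ℝ} (hβ : 1 ≤ β) {s t : ℝ} (hs : 0 ≤ s) (ht : 0 ≤ t) :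
    t ^ β + β * t ^ (β - 1) * (s - t) ≤ s ^ β := by
  rcases ht.eq_or_lt with rfl | ht
  · rcases hβ.eq_or_lt with rfl | hβ
    · simp
    · rw [Real.zero_rpow (by linarith), Real.zero_rpow (by linarith)]
      simpa using Real.rpow_nonneg hs β
  · have h := one_add_mul_self_le_rpow_one_add (s := s / t - 1) (by have := div_nonneg hs ht.le; linarith) hβ
    rw [add_sub_cancel, Real.div_rpow hs ht.le, le_div_iff₀ (Real.rpow_pos_of_pos ht β)] at h
    have e : t ^ β = t ^ (β - 1) * t := by
      rw [← Real.rpow_add_one ht.ne']; ring_nf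
    have : (1 + β * (s / t - 1)) * t ^ β = t ^ β + β * t ^ (β - 1) * (s - t) := by
      have : (s / t - 1) * t = s - t := by field_simp
      calc _ = t ^ β + β * (s / t - 1) * t ^ β := by ring
        _ = t ^ β + β * (s / t - 1) * (t ^ (β - 1) * t) := by rw [← e]
        _ = _ := by rw [← this]; ring
    linarith

theorem psi_tangent {β : ℝ} (hβ : β ∈ Icc (1:ℝ) 2) {s t : ℝ} (hs : 0 < s) (ht : 0 < t) :
    psi β s ≤ psi β t + t ^ (β - 2) * (s - t) := by
  obtain ⟨h1, h2⟩ := hβ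
  unfold psi
  split_ifs with h
  · subst h
    have := Real.log_le_sub_one_of_pos (div_pos hs ht)
    rw [Real.log_div hs.ne' ht.ne'] at this
    have e : t ^ ((1:ℝ) - 2) = t⁻¹ := by rw [← Real.rpow_neg_one]; norm_num
    rw [e]
    have : s / t - 1 = t⁻¹ * (s - t) := by field_simp
    linarith
  · have hb : 0 < β - 1 := by
      have : 1 < β := lt_of_le_of_ne h1 (Ne.symm h)
      linarith
    have h := rpow_one_add_le_one_add_mul_self (s := s / t - 1) (p := β - 1)
      (by have := div_pos hs ht; linarith) hb.le (by linarith)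
    rw [add_sub_cancel, Real.div_rpow hs.le ht.le, div_le_iff₀ (Real.rpow_pos_of_pos ht _)] at h
    have e : t ^ (β - 1) = t ^ (β - 2) * t := by
      rw [← Real.rpow_add_one ht.ne']; ring_nf
    have e2 : (1 + (β - 1) * (s / t - 1)) * t ^ (β - 1)
        = t ^ (β - 1) + (β - 1) * t ^ (β - 2) * (s - t) := by
      have : (s / t - 1) * t = s - t := by field_simp
      calc _ = t ^ (β - 1) + (β - 1) * (s / t - 1) * t ^ (β - 1) := by ring
        _ = t ^ (β - 1) + (β - 1) * (s / t - 1) * (t ^ (β - 2) * t) := by rw [← e]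
        _ = _ := by rw [← this]; ring
    rw [e2] at h
    rw [div_add' _ _ _ hb.ne', div_le_div_iff_of_pos_right hb]
    linarith

theorem psi_key {β : ℝ} (hβ : β ∈ Icc (1:ℝ) 2) {s : ℝ} (hs : 0 ≤ s) :
    (s ^ β - 1) / β ≤ s * psi β s := by
  obtain ⟨h1, h2⟩ := hβ
  rcases hs.eq_or_lt with rfl | hs
  · rw [Real.zero_rpow (by linarith), zero_mul]
    apply div_nonpos_of_nonpos_of_nonneg <;> linarith
  unfold psi
  split_ifs with h
  · subst h
    have := Real.log_le_sub_one_of_pos (inv_pos.2 hs)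
    rw [Real.log_inv] at this
    have := mul_le_mul_of_nonneg_left this hs.le
    rw [mul_sub, mul_inv_cancel₀ hs.ne'] at this
    simp
    linarith
  · have hb : 0 < β - 1 := by
      have : 1 < β := lt_of_le_of_ne h1 (Ne.symm h)
      linarith
    have := pow_tangent h1 hs.le zero_le_one
    simp at this
    have e : s ^ β = s ^ (β - 1) * s := by
      rw [← Real.rpow_add_one hs.ne']; ring_nf
    rw [← mul_div_assoc, div_le_div_iff₀ (by linarith) hb]
    have : s * (s ^ (β - 1) - 1) = s ^ β - s := by rw [e]; ring
    rw [this]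
    nlinarith

noncomputable def hh (β u w s : ℝ) : ℝ := w ^ β * ((s ^ β - 1) / β) - u * w ^ (β - 1) * psi β s

noncomputable def cc (β u w t : ℝ) : ℝ := w ^ β * t ^ (β - 1) - u * w ^ (β - 1) * t ^ (β - 2)

theorem hh_tangent {β : ℝ} (hβ : β ∈ Icc (1:ℝ) 2) {u w s t : ℝ} (hu : 0 ≤ u) (hw : 0 < w)
    (hs : 0 ≤ s) (ht : 0 ≤ t) (h : 0 < u → 0 < s ∧ 0 < t) :
    hh β u w t + cc β u w t * (s - t) ≤ hh β u w s := by
  have hb : 0 < β := by linarith [hβ.1]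
  have h1 : (t ^ β - 1) / β + t ^ (β - 1) * (s - t) ≤ (s ^ β - 1) / β := by
    have := pow_tangent hβ.1 hs ht
    rw [div_add' _ _ _ hb.ne', div_le_div_iff_of_pos_right hb]
    linarith
  have h1 := mul_le_mul_of_nonneg_left h1 (Real.rpow_nonneg hw.le β)
  have h2 : u * w ^ (β - 1) * psi β s ≤ u * w ^ (β - 1) * (psi β t + t ^ (β - 2) * (s - t)) := by
    rcases hu.eq_or_lt with rfl | hu
    · simp
    · exact mul_le_mul_of_nonneg_left (psi_tangent hβ (h hu).1 (h hu).2) (by positivity)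
  unfold hh cc
  linarith

noncomputable def drel (β u v : ℝ) : ℝ :=
  if β = 1 then v - u - u * Real.log (v / u)
  else (u ^ β + (β - 1) * v ^ β - β * u * v ^ (β - 1)) / (β * (β - 1))

theorem dbeta_eq {β : ℝ} (hβ : β ∈ Icc (1:ℝ) 2) {u v : ℝ} (h : 0 < u → 0 < v) :
    dbeta β u v = (drel β u v : EReal) := by
  have h0 : β ≠ 0 := by linarith [hβ.1]
  have h1 : ¬ β < 1 := by linarith [hβ.1]
  have h2 : ¬ (v = 0 ∧ 0 < u) := fun h' => (h h'.2).ne' h'.1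
  unfold dbeta drel
  rw [if_neg h0, if_neg h1, if_neg h2]
  split_ifs <;> rfl

theorem drel_diff {β : ℝ} (hβ : β ∈ Icc (1:ℝ) 2) {u w t : ℝ} (hu : 0 ≤ u) (hw : 0 < w) (ht : 0 ≤ t)
    (h : 0 < u → 0 < t) : drel β u (w * t) - drel β u w = hh β u w t := by
  unfold drel hh psi
  split_ifs with hb
  · subst hb
    simp
    rcases hu.eq_or_lt with rfl | hu
    · simp; ring
    · have ht := h hu
      rw [Real.log_div (by positivity) hu.ne', Real.log_div hw.ne' hu.ne', Real.log_mul hw.ne' ht.ne']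
      ring
  · have hb1 : β - 1 ≠ 0 := sub_ne_zero.2 hb
    have hb0 : β ≠ 0 := by linarith [hβ.1]
    rw [Real.mul_rpow hw.le ht, Real.mul_rpow hw.le ht]
    field_simp
    ring

theorem ereal_coe_sum {m : ℕ} (f : Fin m → ℝ) :
    ((∑ i, f i : ℝ) : EReal) = ∑ i, (f i : EReal) := by
  induction m with
  | zero => simp
  | succ n ih => rw [Fin.sum_univ_succ, Fin.sum_univ_succ, EReal.coe_add, ih]

section
variable {X : Type*} [TopologicalSpace X] {m : ℕ}

theorem PP_nonneg (a : Fin m → C(X, ℝ)) (ha0 : ∀ i x, 0 ≤ a i x)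
    (y : Fin m → ℝ) (hy : ∀ i, 0 ≤ y i) (β : ℝ) (w : Fin m → ℝ) (hw0 : ∀ i, 0 ≤ w i) (x : X) :
    0 ≤ PP a y β w x := by
  refine Finset.sum_nonneg fun i _ => ?_
  split_ifs
  · rfl
  · exact mul_nonneg (mul_nonneg (Real.rpow_nonneg (hw0 i) _) (hy i)) (ha0 i x)

theorem QQ_nonneg (a : Fin m → C(X, ℝ)) (ha0 : ∀ i x, 0 ≤ a i x)
    (β : ℝ) (w : Fin m → ℝ) (hw0 : ∀ i, 0 ≤ w i) (x : X) :
    0 ≤ QQ a β w x :=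
  Finset.sum_nonneg fun i _ => mul_nonneg (Real.rpow_nonneg (hw0 i) _) (ha0 i x)

theorem PP_le (a : Fin m → C(X, ℝ)) (ha0 : ∀ i x, 0 ≤ a i x)
    (y : Fin m → ℝ) (hy : ∀ i, 0 ≤ y i) (β : ℝ) (w : Fin m → ℝ) (hw0 : ∀ i, 0 ≤ w i)
    (hw : ∀ i, 0 < y i → 0 < w i) (x : X) :
    PP a y β w x ≤ (∑ i, y i / w i) * QQ a β w x := by
  unfold PP QQ
  rw [Finset.mul_sum]
  refine Finset.sum_le_sum fun i _ => ?_
  have hn : 0 ≤ ∑ i, y i / w i := Finset.sum_nonneg fun i _ => div_nonneg (hy i) (hw0 i)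
  have hq : 0 ≤ (w i) ^ (β - 1) * a i x := mul_nonneg (Real.rpow_nonneg (hw0 i) _) (ha0 i x)
  split_ifs with h
  · positivity
  · have hwi := hw i (lt_of_le_of_ne (hy i) (Ne.symm h))
    have e : w i ^ (β - 1) = w i ^ (β - 2) * w i := by
      rw [← Real.rpow_add_one hwi.ne']; ring_nf
    have e2 : w i ^ (β - 2) * y i * a i x = (y i / w i) * (w i ^ (β - 1) * a i x) := by
      rw [e]; field_simp
    rw [e2]
    exact mul_le_mul_of_nonneg_right (Finset.single_le_sum (f := fun i => y i / w i)
      (fun i _ => div_nonneg (hy i) (hw0 i)) (Finset.mem_univ i)) hq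

theorem PP_eq (a : Fin m → C(X, ℝ)) (ha0 : ∀ i x, 0 ≤ a i x)
    (y : Fin m → ℝ) (hy : ∀ i, 0 ≤ y i) (β : ℝ) (w : Fin m → ℝ) (hw0 : ∀ i, 0 ≤ w i)
    (hw : ∀ i, 0 < y i → 0 < w i) (x : X) :
    PP a y β w x = ff a y β w x * QQ a β w x := by
  unfold ff
  by_cases h : QQ a β w x = 0
  · have := PP_le a ha0 y hy β w hw0 hw x
    have := PP_nonneg a ha0 y hy β w hw0 x
    rw [h] at *
    linarith
  · field_simp

theorem ff_nonneg (a : Fin m → C(X, ℝ)) (ha0 : ∀ i x, 0 ≤ a i x)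
    (y : Fin m → ℝ) (hy : ∀ i, 0 ≤ y i) (β : ℝ) (w : Fin m → ℝ) (hw0 : ∀ i, 0 ≤ w i) (x : X) :
    0 ≤ ff a y β w x :=
  div_nonneg (PP_nonneg a ha0 y hy β w hw0 x) (QQ_nonneg a ha0 β w hw0 x)

theorem ff_le (a : Fin m → C(X, ℝ)) (ha0 : ∀ i x, 0 ≤ a i x)
    (y : Fin m → ℝ) (hy : ∀ i, 0 ≤ y i) (β : ℝ) (w : Fin m → ℝ) (hw0 : ∀ i, 0 ≤ w i)
    (hw : ∀ i, 0 < y i → 0 < w i) (x : X) :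
    ff a y β w x ≤ ∑ i, y i / w i :=
  div_le_of_le_mul₀ (QQ_nonneg a ha0 β w hw0 x)
    (Finset.sum_nonneg fun i _ => div_nonneg (hy i) (hw0 i)) (PP_le a ha0 y hy β w hw0 hw x)

theorem ff_pos (a : Fin m → C(X, ℝ)) (ha0 : ∀ i x, 0 ≤ a i x)
    (y : Fin m → ℝ) (hy : ∀ i, 0 ≤ y i) (β : ℝ) (w : Fin m → ℝ) (hw0 : ∀ i, 0 ≤ w i)
    (hw : ∀ i, 0 < y i → 0 < w i) (x : X) (i : Fin m) (hi : 0 < y i) (hx : 0 < a i x) :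
    0 < ff a y β w x := by
  have hwi := hw i hi
  have hP : 0 < PP a y β w x := by
    refine Finset.sum_pos' (fun j _ => ?_) ⟨i, Finset.mem_univ i, ?_⟩
    · split_ifs
      · rfl
      · exact mul_nonneg (mul_nonneg (Real.rpow_nonneg (hw0 j) _) (hy j)) (ha0 j x)
    · rw [if_neg hi.ne']; positivity
  have hQ : 0 < QQ a β w x :=
    Finset.sum_pos' (fun j _ => mul_nonneg (Real.rpow_nonneg (hw0 j) _) (ha0 j x))
      ⟨i, Finset.mem_univ i, by positivity⟩
  exact div_pos hP hQ

theorem ff_eq_zero (a : Fin m → C(X, ℝ)) 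
    (y : Fin m → ℝ) (β : ℝ) (w : Fin m → ℝ)  (x : X)
    (h : ∀ i, y i ≠ 0 → a i x = 0) : ff a y β w x = 0 := by
  have : PP a y β w x = 0 := by
    refine Finset.sum_eq_zero fun i _ => ?_
    split_ifs with h'
    · rfl
    · rw [h i h', mul_zero]
  unfold ff
  rw [this, zero_div]

variable [CompactSpace X] [MeasurableSpace X] [BorelSpace X]

theorem ff_measurable (a : Fin m → C(X, ℝ)) (y : Fin m → ℝ) (β : ℝ) (w : Fin m → ℝ) :
    Measurable (ff a y β w) := by
  have h1 : Measurable (PP a y β w) := by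
    unfold PP
    refine Finset.measurable_fun_sum _ fun i _ => ?_
    split_ifs
    · exact measurable_const
    · exact (a i).continuous.measurable.const_mul _
  have h2 : Measurable (QQ a β w) := by
    unfold QQ
    exact Finset.measurable_fun_sum _ fun i _ => (a i).continuous.measurable.const_mul _
  exact h1.div h2

theorem cint (g : C(X, ℝ)) (μ : Measure X) [IsFiniteMeasure μ] : Integrable g μ := by
  refine Integrable.of_bound g.continuous.measurable.aestronglyMeasurable ‖g‖
    (Filter.Eventually.of_forall fun x => g.norm_coe_le_norm x)

theorem wpos (a : Fin m → C(X, ℝ)) (y : Fin m → ℝ) (Ktilde : Set X)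
    (hKt : Ktilde = ⋃ i ∈ {i : Fin m | 0 < y i}, closure {x : X | 0 < a i x})
    (ha0 : ∀ i x, 0 ≤ a i x) (hane : ∀ i, ∃ x, a i x ≠ 0)
    (μ : Measure X) [IsFiniteMeasure μ]
    (hs : Ktilde ⊆ {x : X | ∀ U : Set X, IsOpen U → x ∈ U → 0 < μ U}) (i : Fin m) (hi : 0 < y i) :
    0 < ∫ z, a i z ∂μ := by
  obtain ⟨x, hx⟩ := hane i
  have hx : 0 < a i x := lt_of_le_of_ne (ha0 i x) (Ne.symm hx)
  have hxK : x ∈ Ktilde := by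
    rw [hKt]
    exact mem_biUnion (show i ∈ {i : Fin m | 0 < y i} from hi) (subset_closure hx)
  rw [integral_pos_iff_support_of_nonneg (ha0 i) (cint _ μ)]
  exact hs hxK _ (a i).continuous.isOpen_support hx.ne'

theorem step_finite (a : Fin m → C(X, ℝ)) (ha0 : ∀ i x, 0 ≤ a i x)
    (y : Fin m → ℝ) (hy : ∀ i, 0 ≤ y i) (β : ℝ) (μ : Measure X) [IsFiniteMeasure μ]
    (w : Fin m → ℝ) (hw0 : ∀ i, 0 ≤ w i) (hw : ∀ i, 0 < y i → 0 < w i) :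
    IsFiniteMeasure (μ.withDensity (fun x => ENNReal.ofReal (ff a y β w x))) := by
  apply isFiniteMeasure_withDensity
  have : ∫⁻ x, ENNReal.ofReal (ff a y β w x) ∂μ ≤ ∫⁻ x, ENNReal.ofReal (∑ i, y i / w i) ∂μ :=
    lintegral_mono fun x => ENNReal.ofReal_le_ofReal (ff_le a ha0 y hy β w hw0 hw x)
  refine (this.trans_lt ?_).ne
  rw [lintegral_const]
  exact ENNReal.mul_lt_top ENNReal.ofReal_lt_top (measure_lt_top _ _)

theorem step_integral (a : Fin m → C(X, ℝ)) (ha0 : ∀ i x, 0 ≤ a i x)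
    (y : Fin m → ℝ) (hy : ∀ i, 0 ≤ y i) (β : ℝ) (μ : Measure X)
    (w : Fin m → ℝ) (hw0 : ∀ i, 0 ≤ w i) (g : X → ℝ) :
    ∫ z, g z ∂(μ.withDensity (fun x => ENNReal.ofReal (ff a y β w x))) =
      ∫ z, ff a y β w z * g z ∂μ := by
  rw [integral_withDensity_eq_integral_toReal_smul (ff_measurable a y β w).ennreal_ofReal
    (Filter.Eventually.of_forall fun x => ENNReal.ofReal_lt_top)]
  simp only [ENNReal.toReal_ofReal (ff_nonneg a ha0 y hy β w hw0 _), smul_eq_mul]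

theorem step_supp (a : Fin m → C(X, ℝ)) (ha0 : ∀ i x, 0 ≤ a i x)
    (y : Fin m → ℝ) (hy : ∀ i, 0 ≤ y i) (β : ℝ) (Ktilde : Set X)
    (hKt : Ktilde = ⋃ i ∈ {i : Fin m | 0 < y i}, closure {x : X | 0 < a i x})
    (μ : Measure X)
    (hs : Ktilde ⊆ {x : X | ∀ U : Set X, IsOpen U → x ∈ U → 0 < μ U})
    (w : Fin m → ℝ) (hw0 : ∀ i, 0 ≤ w i) (hw : ∀ i, 0 < y i → 0 < w i) :
    {x : X | ∀ U : Set X, IsOpen U → x ∈ U →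
      0 < (μ.withDensity (fun x => ENNReal.ofReal (ff a y β w x))) U} = Ktilde := by
  have hmeas := (ff_measurable a y β w).ennreal_ofReal
  have hcl : IsClosed Ktilde := by
    rw [hKt]
    exact (Set.toFinite _).isClosed_biUnion fun i _ => isClosed_closure
  apply Subset.antisymm
  · intro x hx
    by_contra hxK
    have := hx Ktildeᶜ hcl.isOpen_compl hxK
    rw [withDensity_apply _ hcl.isOpen_compl.measurableSet] at this
    refine this.ne' ?_
    rw [setLIntegral_congr_fun (g := fun _ => 0) hcl.isOpen_compl.measurableSet]
    · simp
    · intro z hz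
      have : ff a y β w z = 0 := by
        apply ff_eq_zero
        intro i hi
        by_contra hne
        apply hz
        rw [hKt]
        exact mem_biUnion (show i ∈ {i : Fin m | 0 < y i} from lt_of_le_of_ne (hy i) (Ne.symm hi))
          (subset_closure (lt_of_le_of_ne (ha0 i z) (Ne.symm hne)))
      simp [this]
  · intro x hx U hU hxU
    rw [hKt] at hx
    obtain ⟨i, hi, hxi⟩ := mem_iUnion₂.1 hx
    have hi : 0 < y i := hi
    obtain ⟨z, hzU, hz⟩ := mem_closure_iff.1 hxi U hU hxU
    have hop : IsOpen (U ∩ {x : X | 0 < a i x}) :=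
      hU.inter (isOpen_lt continuous_const (a i).continuous)
    have hzK : z ∈ Ktilde := by
      rw [hKt]
      exact mem_biUnion (show i ∈ {i : Fin m | 0 < y i} from hi) (subset_closure hz)
    have h1 := hs hzK _ hop ⟨hzU, hz⟩
    rw [pos_iff_ne_zero]
    intro h0
    rw [withDensity_apply_eq_zero hmeas] at h0
    refine h1.ne' (measure_mono_null ?_ h0)
    rintro t ⟨htU, ht⟩
    refine ⟨?_, htU⟩
    have := ff_pos a ha0 y hy β w hw0 hw t i hi ht
    simpa using this

theorem step_mono (a : Fin m → C(X, ℝ)) (ha0 : ∀ i x, 0 ≤ a i x)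
    (y : Fin m → ℝ) (hy : ∀ i, 0 ≤ y i) (β : ℝ) (hβ : β ∈ Icc (1:ℝ) 2)
    (μ : Measure X) [IsFiniteMeasure μ]
    (w w' : Fin m → ℝ) (hwd : ∀ i, w i = ∫ z, a i z ∂μ)
    (hwd' : ∀ i, w' i = ∫ z, ff a y β w z * a i z ∂μ)
    (hw : ∀ i, 0 < y i → 0 < w i) (hw' : ∀ i, 0 < y i → 0 < w' i) :
    Dbeta β y w' ≤ Dbeta β y w := by
  have hw0 : ∀ i, 0 ≤ w i := fun i => by rw [hwd]; exact integral_nonneg (ha0 i)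
  have hf0 := ff_nonneg a ha0 y hy β w hw0
  have hw0' : ∀ i, 0 ≤ w' i := fun i => by
    rw [hwd']; exact integral_nonneg fun x => mul_nonneg (hf0 x) (ha0 i x)
  have hz : ∀ i, w i = 0 → ∀ᵐ x ∂μ, a i x = 0 := by
    intro i hi
    rw [hwd, integral_eq_zero_iff_of_nonneg (ha0 i) (cint _ μ)] at hi
    exact hi
  have hz' : ∀ i, w i = 0 → w' i = 0 := by
    intro i hi
    rw [hwd']
    apply integral_eq_zero_of_ae
    filter_upwards [hz i hi] with x hx
    simp [hx]
  have hai : ∀ i, Integrable (fun x => a i x) μ := fun i => cint _ μ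
  have hfi : ∀ i, Integrable (fun x => ff a y β w x * a i x) μ := fun i =>
    (hai i).bdd_mul (c := ∑ i, y i / w i) (ff_measurable a y β w).aestronglyMeasurable
      (Filter.Eventually.of_forall fun x => by
        rw [Real.norm_of_nonneg (hf0 x)]; exact ff_le a ha0 y hy β w hw0 hw x)
  have hDw : Dbeta β y w = ((∑ i, drel β (y i) (w i) : ℝ) : EReal) := by
    unfold Dbeta
    rw [ereal_coe_sum]
    exact Finset.sum_congr rfl fun i _ => dbeta_eq hβ (hw i)
  have hDw' : Dbeta β y w' = ((∑ i, drel β (y i) (w' i) : ℝ) : EReal) := by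
    unfold Dbeta
    rw [ereal_coe_sum]
    exact Finset.sum_congr rfl fun i _ => dbeta_eq hβ (hw' i)
  rw [hDw, hDw', EReal.coe_le_coe_iff, ← sub_nonpos, ← Finset.sum_sub_distrib]
  -- junk t = 0 and weights 1 / w = 0 when w = 0
  set t : Fin m → ℝ := fun i => w' i / w i with ht
  have ht0 : ∀ i, 0 ≤ t i := fun i => div_nonneg (hw0' i) (hw0 i)
  have htp : ∀ i, 0 < y i → 0 < t i := fun i hi => div_pos (hw' i hi) (hw i hi)
  set G : Fin m → X → ℝ := fun i x =>
    (w i)⁻¹ * (hh β (y i) (w i) (t i) * a i x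
      + cc β (y i) (w i) (t i) * (ff a y β w x * a i x - t i * a i x)) with hG
  have hGi : ∀ i, Integrable (G i) μ := fun i =>
    (((hai i).const_mul _).add (((hfi i).sub ((hai i).const_mul _)).const_mul _)).const_mul _
  have hGint : ∀ i, ∫ x, G i x ∂μ = drel β (y i) (w' i) - drel β (y i) (w i) := by
    intro i
    have : ∫ x, G i x ∂μ = (w i)⁻¹ * (hh β (y i) (w i) (t i) * w i
      + cc β (y i) (w i) (t i) * (w' i - t i * w i)) := by
      simp only [hG]
      have hsub : Integrable (fun x => cc β (y i) (w i) (t i) *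
          (ff a y β w x * a i x - t i * a i x)) μ :=
        ((hfi i).sub ((hai i).const_mul _)).const_mul _
      rw [integral_const_mul, integral_add ((hai i).const_mul _) hsub, integral_const_mul, integral_const_mul,
        integral_sub (hfi i) ((hai i).const_mul _), integral_const_mul, ← hwd, ← hwd']
    rw [this]
    rcases (hw0 i).eq_or_lt with h | h
    · rw [hz' i h.symm, ← h]; simp
    · have e : w' i = w i * t i := by simp only [ht]; field_simp
      have := drel_diff hβ (hy i) h (ht0 i) (htp i)
      rw [← e] at this
      rw [this, e]
      field_simp
      ring
  simp only [← hGint]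
  rw [← integral_finsetSum _ (fun i _ => hGi i)]
  apply integral_nonpos_of_ae
  have hall : ∀ᵐ x ∂μ, ∀ i, w i = 0 → a i x = 0 := by
    rw [ae_all_iff]
    intro i
    by_cases h : w i = 0
    · filter_upwards [hz i h] with x hx _ using hx
    · exact Filter.Eventually.of_forall fun x h' => absurd h' h
  filter_upwards [hall] with x hx
  show ∑ i, G i x ≤ 0
  set s := ff a y β w x with hs
  have hle : ∀ i, G i x ≤ w i ^ (β - 1) * a i x * ((s ^ β - 1) / β)
      - (if y i = 0 then 0 else w i ^ (β - 2) * y i * a i x) * psi β s := by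
    intro i
    rcases (hw0 i).eq_or_lt with h | h
    · have h1 := hx i h.symm
      simp [hG, h1]
    · have e1 : w i ^ β = w i ^ (β - 1) * w i := by
        rw [← Real.rpow_add_one h.ne']; ring_nf
      have e2 : w i ^ (β - 1) = w i ^ (β - 2) * w i := by
        rw [← Real.rpow_add_one h.ne']; ring_nf
      have eR : w i ^ (β - 1) * a i x * ((s ^ β - 1) / β)
          - (if y i = 0 then 0 else w i ^ (β - 2) * y i * a i x) * psi β s
          = (w i)⁻¹ * a i x * hh β (y i) (w i) s := by
        have : (if y i = 0 then 0 else w i ^ (β - 2) * y i * a i x) = w i ^ (β - 2) * y i * a i x := by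
          split_ifs with h'
          · simp [h']
          · rfl
        rw [this]
        unfold hh
        rw [e1]
        nth_rewrite 3 [e2]
        generalize w i ^ (β - 1) = A
        generalize w i ^ (β - 2) = B
        have := h.ne'
        field_simp
      have eL : G i x = (w i)⁻¹ * a i x * (hh β (y i) (w i) (t i) + cc β (y i) (w i) (t i) * (s - t i)) := by
        simp only [hG]; ring
      rw [eR, eL]
      rcases (ha0 i x).eq_or_lt with h0 | h0
      · rw [← h0]; simp
      · refine mul_le_mul_of_nonneg_left ?_ (by positivity)
        exact hh_tangent hβ (hy i) h (hf0 x) (ht0 i)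
          fun hu => ⟨ff_pos a ha0 y hy β w hw0 hw x i hu h0, htp i hu⟩
  refine (Finset.sum_le_sum fun i _ => hle i).trans ?_
  rw [Finset.sum_sub_distrib, ← Finset.sum_mul, ← Finset.sum_mul]
  change QQ a β w x * ((s ^ β - 1) / β) - PP a y β w x * psi β s ≤ 0
  rw [PP_eq a ha0 y hy β w hw0 hw x, ← hs]
  have := mul_le_mul_of_nonneg_left (psi_key hβ (hf0 x)) (QQ_nonneg a ha0 β w hw0 x)
  rw [← hs] at this
  linarith

end

/-- Multiplicative updates: well-posedness, support properties and
monotone decrease of the β-divergence along the iterates, for β ∈ [1,2]. -/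
theorem stmt13 {p m : ℕ} (hp : 1 ≤ p) (hm : 1 ≤ m)
    (K : Set (EuclideanSpace ℝ (Fin p))) (hK : IsCompact K)
    (a : Fin m → C(K, ℝ)) (ha0 : ∀ i x, 0 ≤ a i x) (hane : ∀ i, ∃ x, a i x ≠ 0)
    (y : Fin m → ℝ) (hy : ∀ i, 0 ≤ y i) (hyne : y ≠ 0)
    (β : ℝ) (hβ : β ∈ Icc (1:ℝ) 2)
    (Ktilde : Set K)
    (hKt : Ktilde = ⋃ i ∈ {i : Fin m | 0 < y i}, closure {x : K | 0 < a i x})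
    (μ₀ : Measure K) (hμ₀ : IsFiniteMeasure μ₀)
    (hsupp₀ : Ktilde ⊆ {x : K | ∀ U : Set K, IsOpen U → x ∈ U → 0 < μ₀ U})
    (μseq : ℕ → Measure K) (hinit : μseq 0 = μ₀)
    (hrec : ∀ k, μseq (k + 1) = (μseq k).withDensity (fun x =>
      ENNReal.ofReal (
        (∑ i, (if y i = 0 then 0 else
          (∫ z, a i z ∂(μseq k)) ^ (β - 2) * y i * a i x)) /
        (∑ i, (∫ z, a i z ∂(μseq k)) ^ (β - 1) * a i x)))) :
    (∀ k, IsFiniteMeasure (μseq k)) ∧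
    (∀ k, 1 ≤ k → ∀ i, 0 < y i → 0 < ∫ z, a i z ∂(μseq k)) ∧
    (∀ k, 1 ≤ k →
      {x : K | ∀ U : Set K, IsOpen U → x ∈ U → 0 < (μseq k) U} = Ktilde) ∧
    (∀ k, Dbeta β y (fun i => ∫ z, a i z ∂(μseq (k + 1))) ≤
      Dbeta β y (fun i => ∫ z, a i z ∂(μseq k))) := by
  haveI : CompactSpace K := isCompact_iff_compactSpace.mp hK
  have inv : ∀ k, IsFiniteMeasure (μseq k) ∧
      Ktilde ⊆ {x : K | ∀ U : Set K, IsOpen U → x ∈ U → 0 < (μseq k) U} := by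
    intro k
    induction k with
    | zero => rw [hinit]; exact ⟨hμ₀, hsupp₀⟩
    | succ k ih =>
      obtain ⟨h1, h2⟩ := ih
      have hw := wpos a y Ktilde hKt ha0 hane (μseq k) h2
      have := hrec k
      exact ⟨by rw [this]; exact step_finite a ha0 y hy β (μseq k) _ (fun i => integral_nonneg (ha0 i)) hw,
        by rw [this]; exact (step_supp a ha0 y hy β Ktilde hKt (μseq k) h2 _ (fun i => integral_nonneg (ha0 i)) hw).ge⟩
  refine ⟨fun k => (inv k).1, ?_, ?_, ?_⟩
  · intro k _ i hi
    haveI := (inv k).1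
    exact wpos a y Ktilde hKt ha0 hane (μseq k) (inv k).2 i hi
  · intro k hk
    obtain ⟨k, rfl⟩ : ∃ j, k = j + 1 := ⟨k - 1, by omega⟩
    haveI := (inv k).1
    have hw := wpos a y Ktilde hKt ha0 hane (μseq k) (inv k).2
    rw [hrec k]
    exact step_supp a ha0 y hy β Ktilde hKt (μseq k) (inv k).2 _ (fun i => integral_nonneg (ha0 i)) hw
  · intro k
    haveI := (inv k).1
    haveI := (inv (k+1)).1
    have hw := wpos a y Ktilde hKt ha0 hane (μseq k) (inv k).2
    have hw' := wpos a y Ktilde hKt ha0 hane (μseq (k+1)) (inv (k+1)).2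
    have hint : ∀ i, ∫ z, a i z ∂(μseq (k+1)) = ∫ z, ff a y β (fun i => ∫ z, a i z ∂(μseq k)) z * a i z ∂(μseq k) := by
      intro i
      rw [hrec k]
      exact step_integral a ha0 y hy β (μseq k) _ (fun i => integral_nonneg (ha0 i)) _
    exact step_mono a ha0 y hy β hβ (μseq k) _ _ (fun i => rfl) (hint) hw hw'
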